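/- Let σ0 ∈ ℝ and a > 0, and let σ_xx, σ_yy, σ_xy be the Kirsch stress field on Ω = {(x,y) ∈ ℝ² : x² + y² > a²}. Then the stress field is in static equilibrium with zero body force on Ω: at every point of Ω, ∂σ_xx/∂x + ∂σ_xy/∂y = 0 and ∂σ_xy/∂x + ∂σ_yy/∂y = 0. -/

import Mathlib

open Real

/-- Polar radius of the point `(x, y)`. -/
noncomputable def polarR (x y : ℝ) : ℝ := Real.sqrt (x ^ 2 + y ^ 2)

/-- Polar angle of the point `(x, y)`. -/
noncomputable def polarTheta (x y : ℝ) : ℝ := Complex.arg ⟨x, y⟩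

/-- Kirsch stress component `σ_xx` as a function of Cartesian coordinates. -/
noncomputable def kirschSxx (σ0 a x y : ℝ) : ℝ :=
  σ0 * (1 - a ^ 2 / polarR x y ^ 2 *
      ((3 / 2) * Real.cos (2 * polarTheta x y) + Real.cos (4 * polarTheta x y)) +
    3 * a ^ 4 / (2 * polarR x y ^ 4) * Real.cos (4 * polarTheta x y))

/-- Kirsch stress component `σ_yy` as a function of Cartesian coordinates. -/
noncomputable def kirschSyy (σ0 a x y : ℝ) : ℝ :=
  σ0 * (-(a ^ 2 / polarR x y ^ 2) *
      ((1 / 2) * Real.cos (2 * polarTheta x y) - Real.cos (4 * polarTheta x y)) -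
    3 * a ^ 4 / (2 * polarR x y ^ 4) * Real.cos (4 * polarTheta x y))

/-- Kirsch stress component `σ_xy` as a function of Cartesian coordinates. -/
noncomputable def kirschSxy (σ0 a x y : ℝ) : ℝ :=
  σ0 * (-(a ^ 2 / polarR x y ^ 2) *
      ((1 / 2) * Real.sin (2 * polarTheta x y) + Real.sin (4 * polarTheta x y)) +
    3 * a ^ 4 / (2 * polarR x y ^ 4) * Real.sin (4 * polarTheta x y))

theorem polarR_sq (x y : ℝ) : polarR x y ^ 2 = x ^ 2 + y ^ 2 :=
  Real.sq_sqrt (by positivity)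

theorem polarR_mul_cos (x y : ℝ) : polarR x y * Real.cos (polarTheta x y) = x := by
  have h := Complex.norm_mul_cos_arg ⟨x, y⟩
  rwa [Complex.norm_eq_sqrt_sq_add_sq] at h

theorem polarR_mul_sin (x y : ℝ) : polarR x y * Real.sin (polarTheta x y) = y := by
  have h := Complex.norm_mul_sin_arg ⟨x, y⟩
  rwa [Complex.norm_eq_sqrt_sq_add_sq] at h

theorem polarR_sq_mul_cos_two (x y : ℝ) :
    polarR x y ^ 2 * Real.cos (2 * polarTheta x y) = x ^ 2 - y ^ 2 := by
  rw [Real.cos_two_mul']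
  linear_combination (polarR x y * Real.cos (polarTheta x y) + x) * polarR_mul_cos x y -
    (polarR x y * Real.sin (polarTheta x y) + y) * polarR_mul_sin x y

theorem polarR_sq_mul_sin_two (x y : ℝ) :
    polarR x y ^ 2 * Real.sin (2 * polarTheta x y) = 2 * x * y := by
  rw [Real.sin_two_mul]
  linear_combination 2 * polarR x y * Real.sin (polarTheta x y) * polarR_mul_cos x y +
    2 * x * polarR_mul_sin x y

theorem polarR_pow_four_mul_cos_four (x y : ℝ) :
    polarR x y ^ 4 * Real.cos (4 * polarTheta x y) =
      (x ^ 2 - y ^ 2) ^ 2 - (2 * x * y) ^ 2 := by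
  rw [show 4 * polarTheta x y = 2 * (2 * polarTheta x y) by ring, Real.cos_two_mul',
    ← polarR_sq_mul_cos_two x y, ← polarR_sq_mul_sin_two x y]
  ring

theorem polarR_pow_four_mul_sin_four (x y : ℝ) :
    polarR x y ^ 4 * Real.sin (4 * polarTheta x y) =
      2 * (x ^ 2 - y ^ 2) * (2 * x * y) := by
  rw [show 4 * polarTheta x y = 2 * (2 * polarTheta x y) by ring, Real.sin_two_mul,
    ← polarR_sq_mul_cos_two x y, ← polarR_sq_mul_sin_two x y]
  ring

/-- The numerator over `(x² + y²)⁴` of the harmonic combination in the Kirsch stresses, as a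
function of `q = x² + y²`, a second-order numerator `u` and a fourth-order numerator `v`. -/
noncomputable def kirschNum (a c d q u v : ℝ) : ℝ :=
  a ^ 2 * (c * u * q ^ 2 + d * v * q) - 3 / 2 * d * a ^ 4 * v

theorem kirschSxx_eq_cartesian (σ0 a x y : ℝ) :
    kirschSxx σ0 a x y = σ0 * (1 - kirschNum a (3 / 2) 1 (x ^ 2 + y ^ 2) (x ^ 2 - y ^ 2)
      ((x ^ 2 - y ^ 2) ^ 2 - (2 * x * y) ^ 2) / (x ^ 2 + y ^ 2) ^ 4) := by
  rcases eq_or_ne (polarR x y) 0 with hr | hr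
  · have hq : x ^ 2 + y ^ 2 = 0 := by rw [← polarR_sq, hr]; norm_num
    simp [kirschSxx, hr, hq]
  · rw [← polarR_pow_four_mul_cos_four, ← polarR_sq_mul_cos_two, ← polarR_sq]
    unfold kirschSxx kirschNum
    field_simp
    ring

theorem kirschSyy_eq_cartesian (σ0 a x y : ℝ) :
    kirschSyy σ0 a x y = σ0 * (0 - kirschNum a (1 / 2) (-1) (x ^ 2 + y ^ 2) (x ^ 2 - y ^ 2)
      ((x ^ 2 - y ^ 2) ^ 2 - (2 * x * y) ^ 2) / (x ^ 2 + y ^ 2) ^ 4) := by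
  rcases eq_or_ne (polarR x y) 0 with hr | hr
  · have hq : x ^ 2 + y ^ 2 = 0 := by rw [← polarR_sq, hr]; norm_num
    simp [kirschSyy, hr, hq]
  · rw [← polarR_pow_four_mul_cos_four, ← polarR_sq_mul_cos_two, ← polarR_sq]
    unfold kirschSyy kirschNum
    field_simp
    ring

theorem kirschSxy_eq_cartesian (σ0 a x y : ℝ) :
    kirschSxy σ0 a x y = σ0 * (0 - kirschNum a (1 / 2) 1 (x ^ 2 + y ^ 2) (2 * x * y)
      (2 * (x ^ 2 - y ^ 2) * (2 * x * y)) / (x ^ 2 + y ^ 2) ^ 4) := by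
  rcases eq_or_ne (polarR x y) 0 with hr | hr
  · have hq : x ^ 2 + y ^ 2 = 0 := by rw [← polarR_sq, hr]; norm_num
    simp [kirschSxy, hr, hq]
  · rw [← polarR_pow_four_mul_sin_four, ← polarR_sq_mul_sin_two, ← polarR_sq]
    unfold kirschSxy kirschNum
    field_simp
    ring

theorem hasDerivAt_kirschNum_div {q u v : ℝ → ℝ} {q' u' v' t : ℝ} (σ0 a b c d : ℝ)
    (hq : HasDerivAt q q' t) (hu : HasDerivAt u u' t) (hv : HasDerivAt v v' t) (h0 : q t ≠ 0) :
    HasDerivAt (fun s => σ0 * (b - kirschNum a c d (q s) (u s) (v s) / q s ^ 4))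
      (-σ0 * ((a ^ 2 * (c * (u' * q t ^ 2 + 2 * u t * q t * q') + d * (v' * q t + v t * q')) -
        3 / 2 * d * a ^ 4 * v') * q t -
        4 * kirschNum a c d (q t) (u t) (v t) * q') / q t ^ 5) t := by
  have hnum : HasDerivAt (fun s => kirschNum a c d (q s) (u s) (v s))
      (a ^ 2 * (c * (u' * q t ^ 2 + 2 * u t * q t * q') + d * (v' * q t + v t * q')) -
        3 / 2 * d * a ^ 4 * v') t := by
    unfold kirschNum
    refine (((((hu.const_mul c).fun_mul (hq.fun_pow 2)).fun_add
      ((hv.const_mul d).fun_mul hq)).const_mul (a ^ 2)).fun_sub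
      (hv.const_mul (3 / 2 * d * a ^ 4))).congr_deriv ?_
    push_cast
    ring
  refine (((hnum.fun_div (hq.fun_pow 4) (pow_ne_zero 4 h0)).const_sub b).const_mul
    σ0).congr_deriv ?_
  field_simp
  push_cast
  ring

/-- **The Kirsch stress field is in static equilibrium with zero body force**
on `Ω = {(x,y) : x² + y² > a²}`: the partial derivatives exist and
`∂σ_xx/∂x + ∂σ_xy/∂y = 0` and `∂σ_xy/∂x + ∂σ_yy/∂y = 0` at every point of `Ω`. -/
theorem kirsch_equilibrium (σ0 a : ℝ) (ha : 0 < a)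
    (x y : ℝ) (h : x ^ 2 + y ^ 2 > a ^ 2) :
    DifferentiableAt ℝ (fun s => kirschSxx σ0 a s y) x ∧
    DifferentiableAt ℝ (fun t => kirschSxy σ0 a x t) y ∧
    DifferentiableAt ℝ (fun s => kirschSxy σ0 a s y) x ∧
    DifferentiableAt ℝ (fun t => kirschSyy σ0 a x t) y ∧
    deriv (fun s => kirschSxx σ0 a s y) x + deriv (fun t => kirschSxy σ0 a x t) y = 0 ∧
    deriv (fun s => kirschSxy σ0 a s y) x + deriv (fun t => kirschSyy σ0 a x t) y = 0 := by
  have h0 : x ^ 2 + y ^ 2 ≠ 0 := (lt_trans (by positivity) h).ne'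
  have sq (t : ℝ) : HasDerivAt (fun s : ℝ => s ^ 2) (2 * t) t := by
    simpa using hasDerivAt_pow 2 t
  have qx : HasDerivAt (fun s : ℝ => s ^ 2 + y ^ 2) (2 * x) x := (sq x).add_const _
  have qy : HasDerivAt (fun t : ℝ => x ^ 2 + t ^ 2) (2 * y) y := (sq y).const_add _
  have Ax : HasDerivAt (fun s : ℝ => s ^ 2 - y ^ 2) (2 * x) x := (sq x).sub_const _
  have Ay : HasDerivAt (fun t : ℝ => x ^ 2 - t ^ 2) (-(2 * y)) y := (sq y).const_sub _
  have Bx : HasDerivAt (fun s : ℝ => 2 * s * y) (2 * y) x := by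
    simpa using ((hasDerivAt_id x).const_mul 2).mul_const y
  have By : HasDerivAt (fun t : ℝ => 2 * x * t) (2 * x) y := by
    simpa using (hasDerivAt_id y).const_mul (2 * x)
  have hxx := hasDerivAt_kirschNum_div σ0 a 1 (3 / 2) 1 qx Ax
    ((Ax.fun_pow 2).fun_sub (Bx.fun_pow 2)) h0
  have hxy_y := hasDerivAt_kirschNum_div σ0 a 0 (1 / 2) 1 qy By
    ((Ay.const_mul 2).fun_mul By) h0
  have hxy_x := hasDerivAt_kirschNum_div σ0 a 0 (1 / 2) 1 qx Bx
    ((Ax.const_mul 2).fun_mul Bx) h0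
  have hyy := hasDerivAt_kirschNum_div σ0 a 0 (1 / 2) (-1) qy Ay
    ((Ay.fun_pow 2).fun_sub (By.fun_pow 2)) h0
  simp only [← kirschSxx_eq_cartesian, ← kirschSyy_eq_cartesian,
    ← kirschSxy_eq_cartesian] at hxx hxy_y hxy_x hyy
  refine ⟨hxx.differentiableAt, hxy_y.differentiableAt, hxy_x.differentiableAt,
    hyy.differentiableAt, ?_, ?_⟩
  · rw [hxx.deriv, hxy_y.deriv, ← add_div, div_eq_zero_iff]
    left
    unfold kirschNum
    push_cast
    ring
  · rw [hxy_x.deriv, hyy.deriv, ← add_div, div_eq_zero_iff]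
    left
    unfold kirschNum
    push_cast
    ring
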